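/- There exists an integer k_0 such that for all integers k ≥ k_0 the following holds. Set A = log k - 2 log log k and T = (e^A - 1)/A, define g : [0,∞) → ℝ by g(t) = 1/(1+At) for t ∈ [0,T] and g(t) = 0 for t > T, and define F_k : [0,∞)^k → ℝ by F_k(t_1,…,t_k) = ∏_{i=1}^k g(k t_i) if t_1 + ⋯ + t_k ≤ 1 and F_k(t_1,…,t_k) = 0 otherwise. Then L_k(F_k) ≤ (log k / k)² · I_k(F_k). -/

import Mathlib

open MeasureTheory

/-- With `A = log k - 2 log log k` and `T = (e^A - 1)/A`, this is the function
`g(t) = 1/(1 + At)` for `t ∈ [0, T]` and `g(t) = 0` otherwise. -/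
noncomputable def gfun (k : ℕ) (t : ℝ) : ℝ :=
  if 0 ≤ t ∧ t ≤ (Real.exp (Real.log k - 2 * Real.log (Real.log k)) - 1) /
      (Real.log k - 2 * Real.log (Real.log k)) then
    1 / (1 + (Real.log k - 2 * Real.log (Real.log k)) * t)
  else 0

/-- `F_k(t₁,…,t_k) = ∏ g(k tᵢ)` if `t₁ + ⋯ + t_k ≤ 1`, and `0` otherwise. -/
noncomputable def Fmay (k : ℕ) (t : Fin k → ℝ) : ℝ :=
  if (∑ i, t i) ≤ 1 then ∏ i, gfun k ((k : ℝ) * t i) else 0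

/-- `I_k(F) = ∫_{[0,∞)^k} F(t)² dt`. -/
noncomputable def Iint (k : ℕ) (F : (Fin k → ℝ) → ℝ) : ℝ :=
  ∫ t in {t : Fin k → ℝ | ∀ i, 0 ≤ t i}, (F t) ^ 2

/-- `L_k(F) = ∫_{[0,∞)^{k-2}} (∫_0^∞ ∫_0^∞ F dt_i dt_j)² dt`, written as
`∫_{[0,∞)^k} F(t) · (∫_0^∞ ∫_0^∞ F(t with coordinates i, j replaced by u, v) du dv) dt`. -/
noncomputable def Lint (k : ℕ) (F : (Fin k → ℝ) → ℝ) (i j : Fin k) : ℝ :=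
  ∫ t in {t : Fin k → ℝ | ∀ l, 0 ≤ t l},
    F t * ∫ u in Set.Ioi (0:ℝ), ∫ v in Set.Ioi (0:ℝ),
      F (Function.update (Function.update t i u) j v)


/-- the truncated function with free parameters -/
lemma gf_nonneg (k : ℕ) (hA : 0 < Real.log k - 2 * Real.log (Real.log k)) (t : ℝ) :
    0 ≤ gfun k t := by
  unfold gfun
  split_ifs with h
  · have := mul_nonneg hA.le h.1
    positivity
  · exact le_rfl

lemma gf_meas (k : ℕ) : Measurable (gfun k) := by
  unfold gfun
  refine Measurable.ite ?_ (by fun_prop) (by fun_prop)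
  exact measurableSet_Icc

/-- general integral of a function cut off to `[0,T]`, by FTC -/
lemma cut_integral (T : ℝ) (hT : 0 ≤ T) (f P p : ℝ → ℝ)
    (hP : ∀ t, 0 ≤ t → HasDerivAt P (p t) t)
    (hp : ContinuousOn p (Set.Icc 0 T))
    (hf : ∀ t, f t = if 0 ≤ t ∧ t ≤ T then p t else 0) :
    Integrable f ∧ ∫ t, f t = P T - P 0 := by
  have h1 : f = (Set.Icc 0 T).indicator p := by
    funext t
    rw [hf, Set.indicator_apply]
    rfl
  have hi : IntegrableOn p (Set.Icc 0 T) := hp.integrableOn_Icc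
  constructor
  · rw [h1]
    exact hi.integrable_indicator measurableSet_Icc
  · rw [h1, integral_indicator measurableSet_Icc, integral_Icc_eq_integral_Ioc,
      ← intervalIntegral.integral_of_le hT]
    refine intervalIntegral.integral_eq_sub_of_hasDerivAt ?_ ?_
    · intro x hx
      rw [Set.uIcc_of_le hT] at hx
      exact hP x hx.1
    · exact ContinuousOn.intervalIntegrable (by rwa [Set.uIcc_of_le hT])

lemma T_nonneg (k : ℕ) (A : ℝ)
    (hAd : Real.log k - 2 * Real.log (Real.log k) = A) (hA : 0 < A) : 0 ≤ (Real.exp A - 1) / A := by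
  have := Real.one_le_exp hA.le
  apply div_nonneg <;> linarith

lemma oneAT (k : ℕ) (A : ℝ)
    (hAd : Real.log k - 2 * Real.log (Real.log k) = A) (hA : 0 < A) : 1 + A * ((Real.exp A - 1) / A) = Real.exp A := by
  field_simp
  ring

lemma int_g (k : ℕ) (A : ℝ)
    (hAd : Real.log k - 2 * Real.log (Real.log k) = A) (hA : 0 < A) : Integrable (gfun k) ∧ ∫ t, gfun k t = 1 := by
  have h := cut_integral ((Real.exp A - 1) / A) (T_nonneg k A hAd hA) (gfun k)
    (fun t => Real.log (1 + A * t) / A) (fun t => 1 / (1 + A * t)) ?_ ?_ ?_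
  · refine ⟨h.1, ?_⟩
    rw [h.2, oneAT k A hAd hA]
    simp [hA.ne']
  · intro t ht
    have : 0 < 1 + A * t := by positivity
    have h1 : HasDerivAt (fun t : ℝ => 1 + A * t) A t := by
      simpa using ((hasDerivAt_id t).const_mul A).const_add 1
    refine ((h1.log this.ne').div_const A).congr_deriv ?_
    field_simp
  · refine ContinuousOn.div (by fun_prop) (by fun_prop) ?_
    intro t ht
    have := mul_nonneg hA.le ht.1
    positivity
  · intro t
    unfold gfun
    rw [hAd]

lemma int_g2 (k : ℕ) (A : ℝ)
    (hAd : Real.log k - 2 * Real.log (Real.log k) = A) (hA : 0 < A) : Integrable (fun t => gfun k t ^ 2) ∧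
    ∫ t, gfun k t ^ 2 = (1 - Real.exp (-A)) / A := by
  have h := cut_integral ((Real.exp A - 1) / A) (T_nonneg k A hAd hA) (fun t => gfun k t ^ 2)
    (fun t => - (1 + A * t)⁻¹ / A) (fun t => (1 / (1 + A * t)) ^ 2) ?_ ?_ ?_
  · refine ⟨h.1, ?_⟩
    rw [h.2, oneAT k A hAd hA, Real.exp_neg]
    simp
    ring
  · intro t ht
    have : 0 < 1 + A * t := by positivity
    have h1 : HasDerivAt (fun t : ℝ => 1 + A * t) A t := by
      simpa using ((hasDerivAt_id t).const_mul A).const_add 1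
    refine (((h1.inv this.ne').neg).div_const A).congr_deriv ?_
    field_simp
  · refine ContinuousOn.pow (ContinuousOn.div (by fun_prop) (by fun_prop) ?_) 2
    intro t ht
    have := mul_nonneg hA.le ht.1
    positivity
  · intro t
    unfold gfun
    rw [hAd]
    split_ifs <;> simp

lemma int_tg2 (k : ℕ) (A : ℝ)
    (hAd : Real.log k - 2 * Real.log (Real.log k) = A) (hA : 0 < A) : Integrable (fun t => gfun k t ^ 2 * t) ∧
    ∫ t, gfun k t ^ 2 * t = (A - 1 + Real.exp (-A)) / A ^ 2 := by
  have h := cut_integral ((Real.exp A - 1) / A) (T_nonneg k A hAd hA)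
    (fun t => gfun k t ^ 2 * t)
    (fun t => (Real.log (1 + A * t) + (1 + A * t)⁻¹) / A ^ 2)
    (fun t => (1 / (1 + A * t)) ^ 2 * t) ?_ ?_ ?_
  · refine ⟨h.1, ?_⟩
    rw [h.2, oneAT k A hAd hA, Real.exp_neg]
    simp
    ring
  · intro t ht
    have : 0 < 1 + A * t := by positivity
    have h1 : HasDerivAt (fun t : ℝ => 1 + A * t) A t := by
      simpa using ((hasDerivAt_id t).const_mul A).const_add 1
    refine (((h1.log this.ne').add (h1.inv this.ne')).div_const (A ^ 2)).congr_deriv ?_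
    field_simp
    ring
  · refine ContinuousOn.mul (ContinuousOn.pow
      (ContinuousOn.div (by fun_prop) (by fun_prop) ?_) 2) (by fun_prop)
    intro t ht
    have := mul_nonneg hA.le ht.1
    positivity
  · intro t
    unfold gfun
    rw [hAd]
    split_ifs <;> simp

lemma F_le (k : ℕ) (A : ℝ)
    (hAd : Real.log k - 2 * Real.log (Real.log k) = A) (hA : 0 < A) (t : Fin k → ℝ) : Fmay k t ≤ ∏ i, gfun k (k * t i) := by
  unfold Fmay
  split_ifs
  · exact le_rfl
  · exact Finset.prod_nonneg fun i _ => gf_nonneg k (hAd ▸ hA) _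

lemma F_nonneg (k : ℕ) (A : ℝ)
    (hAd : Real.log k - 2 * Real.log (Real.log k) = A) (hA : 0 < A) (t : Fin k → ℝ) : 0 ≤ Fmay k t := by
  unfold Fmay
  split_ifs
  · exact Finset.prod_nonneg fun i _ => gf_nonneg k (hAd ▸ hA) _
  · exact le_rfl

lemma scale (k : ℕ) (A : ℝ)
    (hAd : Real.log k - 2 * Real.log (Real.log k) = A) (hA : 0 < A) (hk : 0 < k) (f : ℝ → ℝ) (hf : Integrable f) :
    Integrable (fun t : ℝ => f (k * t)) ∧ ∫ t : ℝ, f (k * t) = (∫ t, f t) / k := by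
  have hk' : (0:ℝ) < k := by exact_mod_cast hk
  refine ⟨hf.comp_mul_left' hk'.ne', ?_⟩
  rw [Measure.integral_comp_mul_left]
  rw [abs_of_pos (by positivity), smul_eq_mul]
  ring

lemma inner_le (k : ℕ) (A : ℝ)
    (hAd : Real.log k - 2 * Real.log (Real.log k) = A) (hA : 0 < A) (hk : 0 < k) (i j : Fin k) (hij : i ≠ j) (t : Fin k → ℝ) :
    ∫ u in Set.Ioi (0:ℝ), ∫ v in Set.Ioi (0:ℝ),
      Fmay k (Function.update (Function.update t i u) j v) ≤
      (∏ l, if l = i ∨ l = j then 1 else gfun k (k * t l)) * (1 / k) * (1 / k) := by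
  have hg := gf_nonneg k (hAd ▸ hA)
  obtain ⟨hi, hv⟩ := scale k A hAd hA hk _ (int_g k A hAd hA).1
  rw [(int_g k A hAd hA).2] at hv
  have hle : ∫ u in Set.Ioi (0:ℝ), gfun k (k * u) ≤ 1 / k := by
    rw [← hv]
    exact setIntegral_le_integral hi (Filter.Eventually.of_forall fun x => hg _)
  set w := (∏ l, if l = i ∨ l = j then 1 else gfun k (k * t l)) with hw
  have hw0 : 0 ≤ w := Finset.prod_nonneg fun l _ => by
    split_ifs
    · exact zero_le_one
    · exact hg _
  have hpt : ∀ u v, Fmay k (Function.update (Function.update t i u) j v) ≤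
      w * gfun k (k * u) * gfun k (k * v) := by
    intro u v
    refine (F_le k A hAd hA _).trans (le_of_eq ?_)
    have e1 : gfun k (k * u) = ∏ l, if l = i then gfun k (k * u) else 1 := by simp
    have e2 : gfun k (k * v) = ∏ l, if l = j then gfun k (k * v) else 1 := by simp
    rw [e1, e2, hw, ← Finset.prod_mul_distrib, ← Finset.prod_mul_distrib]
    refine Finset.prod_congr rfl fun l _ => ?_
    by_cases h1 : l = j
    · subst h1
      simp [hij.symm]
    · by_cases h2 : l = i
      · subst h2
        simp [h1]
      · simp [h1, h2]
  have h1 : ∀ u, ∫ v in Set.Ioi (0:ℝ), Fmay k (Function.update (Function.update t i u) j v) ≤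
      w * gfun k (k * u) * (1 / k) := by
    intro u
    calc _ ≤ ∫ v in Set.Ioi (0:ℝ), w * gfun k (k * u) * gfun k (k * v) := by
          refine integral_mono_of_nonneg ?_ (hi.integrableOn.const_mul _) ?_
          · exact Filter.Eventually.of_forall fun v => F_nonneg k A hAd hA _
          · exact Filter.Eventually.of_forall fun v => hpt u v
      _ = w * gfun k (k * u) * ∫ v in Set.Ioi (0:ℝ), gfun k (k * v) := integral_const_mul _ _
      _ ≤ _ := mul_le_mul_of_nonneg_left hle (mul_nonneg hw0 (hg _))
  calc _ ≤ ∫ u in Set.Ioi (0:ℝ), (w * (1 / k)) * gfun k (k * u) := by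
          refine integral_mono_of_nonneg ?_ (hi.integrableOn.const_mul _) ?_
          · exact Filter.Eventually.of_forall fun u =>
              integral_nonneg fun v => F_nonneg k A hAd hA _
          · refine Filter.Eventually.of_forall fun u => (h1 u).trans (le_of_eq ?_)
            ring
      _ = (w * (1 / k)) * ∫ u in Set.Ioi (0:ℝ), gfun k (k * u) := integral_const_mul _ _
      _ ≤ _ := mul_le_mul_of_nonneg_left hle (by positivity)

lemma L_le (k : ℕ) (A : ℝ)
    (hAd : Real.log k - 2 * Real.log (Real.log k) = A) (hA : 0 < A) (hk : 2 ≤ k) (i j : Fin k) (hij : i ≠ j) :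
    Lint k (Fmay k) i j ≤ (1 / k) ^ 4 * ((1 - Real.exp (-A)) / A / k) ^ (k - 2) := by
  have hg := gf_nonneg k (hAd ▸ hA)
  obtain ⟨hi, hv⟩ := scale k A hAd hA (by omega) _ (int_g k A hAd hA).1
  rw [(int_g k A hAd hA).2] at hv
  obtain ⟨hi2, hv2⟩ := scale k A hAd hA (by omega) _ (int_g2 k A hAd hA).1
  rw [(int_g2 k A hAd hA).2] at hv2
  let φ : Fin k → ℝ → ℝ := fun l s =>
    if l = i ∨ l = j then gfun k (k * s) else gfun k (k * s) ^ 2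
  have hφ0 : ∀ l s, 0 ≤ φ l s := by
    intro l s
    simp only [φ]
    split_ifs
    · exact hg _
    · positivity
  have hφi : ∀ l, Integrable (φ l) := by
    intro l
    by_cases h : l = i ∨ l = j
    · simpa [φ, h] using hi
    · simpa [φ, h] using hi2
  have hΦ : Integrable (fun t : Fin k → ℝ => (1 / (k:ℝ)) ^ 2 * ∏ l, φ l (t l)) :=
    (Integrable.fintype_prod (f := φ) hφi).const_mul _
  have hΦ0 : ∀ t : Fin k → ℝ, 0 ≤ (1 / (k:ℝ)) ^ 2 * ∏ l, φ l (t l) := fun t =>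
    mul_nonneg (by positivity) (Finset.prod_nonneg fun l _ => hφ0 l _)
  have hin0 : ∀ t : Fin k → ℝ, 0 ≤ ∫ u in Set.Ioi (0:ℝ), ∫ v in Set.Ioi (0:ℝ),
      Fmay k (Function.update (Function.update t i u) j v) := fun t =>
    integral_nonneg fun u => integral_nonneg fun v => F_nonneg k A hAd hA _
  have hval : ∏ l, ∫ s, φ l s = (1 / k) ^ 2 * ((1 - Real.exp (-A)) / A / k) ^ (k - 2) := by
    have : ∀ l, ∫ s, φ l s = if l ∈ ({i, j} : Finset (Fin k)) then (1 / (k:ℝ)) else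
        ((1 - Real.exp (-A)) / A / k) := by
      intro l
      by_cases h : l = i ∨ l = j
      · simpa [φ, h] using hv
      · simpa [φ, h] using hv2
    simp_rw [this]
    rw [Finset.prod_ite, Finset.prod_const, Finset.prod_const]
    have c1 : (Finset.univ.filter (fun l => l ∈ ({i, j} : Finset (Fin k)))).card = 2 := by
      rw [Finset.filter_mem_eq_inter, Finset.univ_inter, Finset.card_pair hij]
    have c2 : (Finset.univ.filter (fun l => l ∉ ({i, j} : Finset (Fin k)))).card = k - 2 := by
      rw [Finset.filter_not, Finset.card_sdiff_of_subset (Finset.filter_subset _ _), c1]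
      simp
    rw [c1, c2]
  unfold Lint
  calc _ ≤ ∫ t in {t : Fin k → ℝ | ∀ l, 0 ≤ t l}, (1 / (k:ℝ)) ^ 2 * ∏ l, φ l (t l) := by
        refine integral_mono_of_nonneg ?_ hΦ.integrableOn ?_
        · exact Filter.Eventually.of_forall fun t => mul_nonneg (F_nonneg k A hAd hA _) (hin0 t)
        · refine Filter.Eventually.of_forall fun t => ?_
          refine (mul_le_mul (F_le k A hAd hA t) (inner_le k A hAd hA (by omega) i j hij t)
            (hin0 t) (Finset.prod_nonneg fun i _ => hg _)).trans (le_of_eq ?_)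
          have : ∏ l, φ l (t l) = (∏ l, gfun k (k * t l)) *
              ∏ l, if l = i ∨ l = j then 1 else gfun k (k * t l) := by
            rw [← Finset.prod_mul_distrib]
            refine Finset.prod_congr rfl fun l _ => ?_
            simp only [φ]
            split_ifs
            · simp
            · ring
          simp only [this]
          ring
    _ ≤ ∫ t : Fin k → ℝ, (1 / (k:ℝ)) ^ 2 * ∏ l, φ l (t l) :=
        setIntegral_le_integral hΦ (Filter.Eventually.of_forall hΦ0)
    _ = (1 / (k:ℝ)) ^ 2 * ∏ l, ∫ s, φ l s := by
        rw [integral_const_mul, integral_fintype_prod_volume_eq_prod]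
    _ = _ := by rw [hval]; ring

lemma I_ge (k : ℕ) (A : ℝ)
    (hAd : Real.log k - 2 * Real.log (Real.log k) = A) (hA : 0 < A) (hk : 0 < k) (lam c : ℝ) (hc : 0 ≤ c)
    (hlc : ∀ s, 0 ≤ s → s ≤ (Real.exp A - 1) / A → Real.exp (lam * s) ≤ 1 + c * s)
    (hlam : 0 ≤ lam) :
    ((1 - Real.exp (-A)) / A / k) ^ k - Real.exp (- (lam * k)) *
      (((1 - Real.exp (-A)) / A + c * ((A - 1 + Real.exp (-A)) / A ^ 2)) / k) ^ k
      ≤ Iint k (Fmay k) := by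
  have hk' : (0:ℝ) < k := by exact_mod_cast hk
  have hg := gf_nonneg k (hAd ▸ hA)
  obtain ⟨hi2, hv2⟩ := scale k A hAd hA hk _ (int_g2 k A hAd hA).1
  rw [(int_g2 k A hAd hA).2] at hv2
  obtain ⟨hi3, hv3⟩ := scale k A hAd hA hk
    (fun s => gfun k s ^ 2 + c * (gfun k s ^ 2 * s))
    ((int_g2 k A hAd hA).1.add ((int_tg2 k A hAd hA).1.const_mul c))
  rw [integral_add (int_g2 k A hAd hA).1 ((int_tg2 k A hAd hA).1.const_mul c),
    integral_const_mul, (int_g2 k A hAd hA).2, (int_tg2 k A hAd hA).2] at hv3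
  have hP2 : Integrable (fun t : Fin k → ℝ => ∏ l, gfun k (k * t l) ^ 2) :=
    Integrable.fintype_prod (f := fun _ s => gfun k (k * s) ^ 2) fun _ => hi2
  have hP3 : Integrable (fun t : Fin k → ℝ =>
      ∏ l, (gfun k (k * t l) ^ 2 + c * (gfun k (k * t l) ^ 2 * (k * t l)))) :=
    Integrable.fintype_prod
      (f := fun _ s => gfun k (k * s) ^ 2 + c * (gfun k (k * s) ^ 2 * (k * s))) fun _ => hi3
  have hpt1 : ∀ s, gfun k s ^ 2 * Real.exp (lam * s) ≤
      gfun k s ^ 2 + c * (gfun k s ^ 2 * s) := by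
    intro s
    by_cases h : 0 ≤ s ∧ s ≤ (Real.exp A - 1) / A
    · have := mul_le_mul_of_nonneg_left (hlc s h.1 h.2) (sq_nonneg (gfun k s))
      linarith
    · have : gfun k s = 0 := by
        unfold gfun
        rw [hAd, if_neg h]
      simp [this]
  have hF2 : ∀ t, Fmay k t ^ 2 ≤ ∏ l, gfun k (k * t l) ^ 2 := by
    intro t
    rw [Finset.prod_pow]
    exact pow_le_pow_left₀ (F_nonneg k A hAd hA t) (F_le k A hAd hA t) 2
  have hmeas : Measurable (Fmay k) := by
    unfold Fmay
    refine Measurable.ite ?_ ?_ measurable_const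
    · exact measurableSet_le (by fun_prop) measurable_const
    · refine Finset.measurable_prod _ fun i _ => (gf_meas k).comp (by fun_prop)
  have hFi : Integrable (fun t => Fmay k t ^ 2) := by
    refine hP2.mono' (hmeas.pow_const 2).aestronglyMeasurable
      (Filter.Eventually.of_forall fun t => ?_)
    rw [Real.norm_eq_abs, abs_of_nonneg (sq_nonneg _)]
    exact hF2 t
  have hpt : ∀ t : Fin k → ℝ, (∏ l, gfun k (k * t l) ^ 2) - Real.exp (- (lam * k)) *
      (∏ l, (gfun k (k * t l) ^ 2 + c * (gfun k (k * t l) ^ 2 * (k * t l)))) ≤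
      Fmay k t ^ 2 := by
    intro t
    have h1 : (∏ l, gfun k (k * t l) ^ 2) * Real.exp (lam * k * ∑ l, t l) ≤
        (∏ l, (gfun k (k * t l) ^ 2 + c * (gfun k (k * t l) ^ 2 * (k * t l)))) := by
      rw [Finset.mul_sum, Real.exp_sum, ← Finset.prod_mul_distrib]
      refine Finset.prod_le_prod (fun l _ => by positivity) fun l _ => ?_
      have := hpt1 (k * t l)
      rwa [← mul_assoc] at this
    have h0 : 0 ≤ ∏ l, gfun k (k * t l) ^ 2 := Finset.prod_nonneg fun _ _ => sq_nonneg _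
    by_cases hs : ∑ i, t i ≤ 1
    · have : Fmay k t ^ 2 = ∏ l, gfun k (k * t l) ^ 2 := by
        unfold Fmay
        rw [if_pos hs, Finset.prod_pow]
      rw [this]
      have := mul_nonneg (Real.exp_pos (- (lam * k))).le
        ((mul_nonneg h0 (Real.exp_pos _).le).trans h1)
      linarith
    · have h2 : Fmay k t ^ 2 = 0 := by
        unfold Fmay
        rw [if_neg hs]; norm_num
      rw [h2]
      push Not at hs
      have h3 : (∏ l, gfun k (k * t l) ^ 2) * Real.exp (lam * k) ≤
          (∏ l, (gfun k (k * t l) ^ 2 + c * (gfun k (k * t l) ^ 2 * (k * t l)))) := by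
        refine le_trans (mul_le_mul_of_nonneg_left (Real.exp_le_exp.2 ?_) h0) h1
        exact le_mul_of_one_le_right (by positivity) hs.le
      have h4 := mul_le_mul_of_nonneg_left h3 (Real.exp_pos (- (lam * k))).le
      have h5 : Real.exp (- (lam * k)) * Real.exp (lam * k) = 1 := by
        rw [← Real.exp_add]; simp
      have h6 : Real.exp (- (lam * k)) * ((∏ l, gfun k (k * t l) ^ 2) * Real.exp (lam * k))
        = ∏ l, gfun k (k * t l) ^ 2 := by
        rw [mul_left_comm, h5, mul_one]
      linarith
  have hfull : Iint k (Fmay k) = ∫ t, Fmay k t ^ 2 := by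
    unfold Iint
    refine setIntegral_eq_integral_of_forall_compl_eq_zero fun t ht => ?_
    simp only [Set.mem_ofPred_eq, not_forall, not_le] at ht
    obtain ⟨i, hi⟩ := ht
    have : Fmay k t = 0 := by
      unfold Fmay
      split_ifs
      · refine Finset.prod_eq_zero (Finset.mem_univ i) ?_
        unfold gfun
        rw [if_neg]
        rintro ⟨h, -⟩
        nlinarith
      · rfl
    rw [this]; norm_num
  rw [hfull]
  refine le_trans (le_of_eq ?_) (integral_mono (hP2.sub (hP3.const_mul _)) hFi hpt)
  simp only [Pi.sub_apply]
  rw [integral_sub hP2 (hP3.const_mul _), integral_const_mul,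
    integral_fintype_prod_volume_eq_prod (f := fun _ s => gfun k (k * s) ^ 2),
    integral_fintype_prod_volume_eq_prod
      (f := fun _ s => gfun k (k * s) ^ 2 + c * (gfun k (k * s) ^ 2 * (k * s))), hv2, hv3]
  simp only [Finset.prod_const, Finset.card_univ, Fintype.card_fin]

set_option maxHeartbeats 1000000 in
/-- the numeric part of the comparison -/
lemma numeric (k : ℕ) (hk : 2 ≤ k) (L A : ℝ) (hL : L = Real.log k)
    (hAd : A = L - 2 * Real.log L) (hL2 : 2 ≤ L) (hA : 1 ≤ A) (hlog : 1 ≤ Real.log L)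
    (h1 : Real.exp (-A) ≤ 1 / (4 * L)) (h2 : Real.exp (-(L / 16)) ≤ 1 / (2 * L))
    (h3 : (A + 1) * Real.exp (-A) ≤ 1 / 2) :
    ∃ lam c : ℝ, 0 ≤ lam ∧ 0 ≤ c ∧
      (∀ s, 0 ≤ s → s ≤ (Real.exp A - 1) / A → Real.exp (lam * s) ≤ 1 + c * s) ∧
      (1 / (k:ℝ)) ^ 4 * ((1 - Real.exp (-A)) / A / k) ^ (k - 2) ≤ (L / k) ^ 2 *
      (((1 - Real.exp (-A)) / A / k) ^ k - Real.exp (- (lam * k)) *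
      (((1 - Real.exp (-A)) / A + c * ((A - 1 + Real.exp (-A)) / A ^ 2)) / k) ^ k) := by
  have hk0 : (0:ℝ) < k := by exact_mod_cast (by omega : 0 < k)
  have hA0 : 0 < A := by linarith
  have hL0 : 0 < L := by linarith
  set E := Real.exp A with hE
  set e := Real.exp (-A) with he
  have hE1 : 1 < E := by rw [hE]; exact Real.one_lt_exp_iff.2 hA0
  have he0 : 0 < e := Real.exp_pos _
  have he1 : e ≤ 1 / 4 := by nlinarith
  have hEk : E * L ^ 2 = k := by
    rw [hE, hAd, Real.exp_sub, hL, Real.exp_log hk0, ← hL]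
    have : Real.exp (2 * Real.log L) = L ^ 2 := by
      rw [two_mul, Real.exp_add, Real.exp_log hL0, sq]
    rw [this]
    field_simp
  set T := (E - 1) / A with hT
  have hT0 : 0 < T := div_pos (by linarith) hA0
  set ε := 1 / (4 * A) with hε
  have hε0 : 0 < ε := by positivity
  have hε1 : ε ≤ 1 := by
    rw [hε, div_le_one (by positivity)]; linarith
  have hεA : ε * A = 1 / 4 := by rw [hε]; field_simp
  set γ := (1 - e) / A with hγ
  have hγ0 : 0 < γ := div_pos (by linarith) hA0
  have hγA : γ * A = 1 - e := by rw [hγ]; field_simp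
  refine ⟨ε / T, ε / T * (1 + ε), by positivity, by positivity, ?_, ?_⟩
  · intro s hs hsT
    have hx0 : 0 ≤ ε / T * s := by positivity
    have hx1 : ε / T * s ≤ ε := by
      rw [div_mul_eq_mul_div, div_le_iff₀ hT0]
      exact mul_le_mul_of_nonneg_left hsT hε0.le
    have := Real.abs_exp_sub_one_sub_id_le (x := ε / T * s)
      (by rw [abs_of_nonneg hx0]; linarith)
    have := (abs_le.1 this).2
    nlinarith
  · set lam := ε / T with hlam
    have hlam0 : 0 < lam := by positivity
    set m := (A - 1 + e) / A ^ 2 with hm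
    -- `(1+ε) m ≤ γ (1 - 1/(4A))`
    have hmA : m * A ^ 2 = A - 1 + e := by rw [hm]; field_simp
    have hm0 : 0 ≤ m := by rw [hm]; apply div_nonneg <;> nlinarith
    have hmu : (1 + ε) * m ≤ γ * (1 - ε) := by
      have hm' : m = (A - 1 + e) / A ^ 2 := hm
      rw [hm', hγ, hε]
      rw [← sub_nonneg]
      have : (1 - e) / A * (1 - 1 / (4 * A)) - (1 + 1 / (4 * A)) * ((A - 1 + e) / A ^ 2)
        = ((1 - e) * (4 * A - 1) * A - (4 * A + 1) * (A - 1 + e)) / (4 * A ^ 3) := by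
        field_simp
      rw [this]
      apply div_nonneg _ (by positivity)
      nlinarith [mul_pos hA0 he0]
    have hJ : γ + lam * (1 + ε) * m ≤ γ * Real.exp (lam * (1 - ε)) := by
      have := Real.add_one_le_exp (lam * (1 - ε))
      have := mul_le_mul_of_nonneg_left this hγ0.le
      have := mul_le_mul_of_nonneg_left hmu hlam0.le
      nlinarith
    have hJ0 : 0 ≤ γ + lam * (1 + ε) * m := by positivity
    have htail : Real.exp (-(lam * k)) * ((γ + lam * (1 + ε) * m) / k) ^ k ≤
        (γ / k) ^ k * (1 / (2 * L)) := by
      have hp : ((γ + lam * (1 + ε) * m) / k) ^ k ≤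
          (γ / k) ^ k * Real.exp (k * (lam * (1 - ε))) := by
        rw [Real.exp_nat_mul, ← mul_pow]
        refine pow_le_pow_left₀ (by positivity) ?_ k
        rw [div_mul_eq_mul_div γ]
        exact div_le_div_of_nonneg_right hJ hk0.le
      refine (mul_le_mul_of_nonneg_left hp (Real.exp_pos _).le).trans ?_
      rw [mul_left_comm, ← Real.exp_add]
      refine mul_le_mul_of_nonneg_left (le_trans (Real.exp_le_exp.2 ?_) h2) (by positivity)
      have hkey : L / 16 ≤ lam * k * ε := by
        have : lam * k * ε = L ^ 2 * E / (16 * A * (E - 1)) := by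
          rw [hlam, hε, hT, ← hEk]
          have : E - 1 ≠ 0 := by linarith
          field_simp
          norm_num
        rw [this, div_le_div_iff₀ (by norm_num) (by
          have : 0 < E - 1 := by linarith
          positivity)]
        have hAL : A ≤ L := by linarith
        have : A * (E - 1) ≤ L * E := mul_le_mul hAL (by linarith) (by linarith) hL0.le
        have := mul_le_mul_of_nonneg_left this (by positivity : 0 ≤ 16 * L)
        linarith
      have : -(lam * k) + k * (lam * (1 - ε)) = -(lam * k * ε) := by ring
      rw [this]
      linarith
    have hmain : 1 ≤ L ^ 2 * γ ^ 2 * (1 - 1 / (2 * L)) := by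
      have hq : (1 + 1 / L) ≤ L * γ := by
        rw [hγ, mul_div_assoc', le_div_iff₀ hA0]
        have hAL : A ≤ L - 2 := by linarith
        have h1' : e * L ≤ 1 / 4 := by
          rw [le_div_iff₀ (by positivity)] at h1
          linarith
        have : (1 + 1 / L) * A ≤ (1 + 1 / L) * (L - 2) :=
          mul_le_mul_of_nonneg_left hAL (by positivity)
        have h4 : (1 + 1 / L) * (L - 2) = L - 1 - 2 / L := by field_simp; ring
        have : 0 < 2 / L := by positivity
        nlinarith
      have hx : 0 < 1 / L := by positivity
      have hx1 : 1 / L ≤ 1 / 2 := one_div_le_one_div_of_le (by norm_num) hL2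
      have h5 : 1 / (2 * L) = (1 / L) / 2 := by field_simp
      rw [← mul_pow, h5]
      have : (1 + 1 / L) ^ 2 ≤ (L * γ) ^ 2 := pow_le_pow_left₀ (by positivity) hq 2
      have := mul_le_mul_of_nonneg_right this (by linarith : 0 ≤ 1 - 1 / L / 2)
      generalize 1 / L = x at *
      have h7 : 0 ≤ x * (3 - x ^ 2) := mul_nonneg hx.le (by nlinarith)
      nlinarith
    obtain ⟨n, rfl⟩ : ∃ n, k = n + 2 := ⟨k - 2, by omega⟩
    rw [Nat.add_sub_cancel]
    set K : ℝ := ((n + 2 : ℕ) : ℝ) with hK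
    have hP : 0 ≤ (1 / K) ^ 4 * (γ / K) ^ n := by positivity
    calc (1 / K) ^ 4 * (γ / K) ^ n
        ≤ (1 / K) ^ 4 * (γ / K) ^ n * (L ^ 2 * γ ^ 2 * (1 - 1 / (2 * L))) :=
          le_mul_of_one_le_right hP hmain
      _ = (L / K) ^ 2 * ((γ / K) ^ (n + 2) - (γ / K) ^ (n + 2) * (1 / (2 * L))) := by
          rw [pow_add (γ / K) n 2, div_pow L, div_pow γ K 2, div_pow 1 K 4]
          field_simp
      _ ≤ _ := by
          refine mul_le_mul_of_nonneg_left ?_ (by positivity)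
          linarith

lemma eventually_conds : ∀ᶠ L : ℝ in Filter.atTop, 2 ≤ L ∧ 1 ≤ L - 2 * Real.log L ∧
    1 ≤ Real.log L ∧ Real.exp (-(L - 2 * Real.log L)) ≤ 1 / (4 * L) ∧
    Real.exp (-(L / 16)) ≤ 1 / (2 * L) ∧
    (L - 2 * Real.log L + 1) * Real.exp (-(L - 2 * Real.log L)) ≤ 1 / 2 := by
  have hA : Filter.Tendsto (fun L : ℝ => L - 2 * Real.log L) Filter.atTop Filter.atTop := by
    have h : (fun L : ℝ => 2 * Real.log L) =o[Filter.atTop] (fun L : ℝ => L) :=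
      Real.isLittleO_log_id_atTop.const_mul_left 2
    refine Filter.tendsto_atTop_mono' _ ?_
      (Filter.tendsto_id.atTop_div_const (by norm_num : (0:ℝ) < 2))
    filter_upwards [h.bound (by norm_num : (0:ℝ) < 1 / 2), Filter.eventually_ge_atTop 1]
      with L h1 h2
    rw [Real.norm_eq_abs, Real.norm_eq_abs, abs_of_nonneg (by linarith : 0 ≤ L)] at h1
    have := le_abs_self (2 * Real.log L)
    simp only [id]
    linarith
  have t3 : Filter.Tendsto (fun L : ℝ => L ^ 3 * Real.exp (-L)) Filter.atTop (nhds 0) :=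
    Real.tendsto_pow_mul_exp_neg_atTop_nhds_zero 3
  have t1 : Filter.Tendsto (fun L : ℝ => (L / 16) ^ 1 * Real.exp (-(L / 16)))
      Filter.atTop (nhds 0) :=
    (Real.tendsto_pow_mul_exp_neg_atTop_nhds_zero 1).comp
      (Filter.tendsto_id.atTop_div_const (by norm_num : (0:ℝ) < 16))
  filter_upwards [Filter.eventually_ge_atTop 2, hA.eventually_ge_atTop 1,
    Real.tendsto_log_atTop.eventually_ge_atTop 1,
    t3.eventually_le_const (by norm_num : (0:ℝ) < 1 / 4),
    t1.eventually_le_const (by norm_num : (0:ℝ) < 1 / 32)] with L h1 h2 h3 h4 h5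
  have hL0 : 0 < L := by linarith
  have hexp : Real.exp (-(L - 2 * Real.log L)) = L ^ 2 * Real.exp (-L) := by
    rw [neg_sub, sub_eq_add_neg, Real.exp_add, two_mul, Real.exp_add, Real.exp_log hL0, sq]
  have hp := Real.exp_pos (-L)
  refine ⟨h1, h2, h3, ?_, ?_, ?_⟩
  · rw [hexp, le_div_iff₀ (by positivity)]
    nlinarith
  · rw [le_div_iff₀ (by positivity)]
    nlinarith
  · rw [hexp]
    have : L - 2 * Real.log L + 1 ≤ L := by linarith
    have := mul_le_mul_of_nonneg_right this (by positivity : 0 ≤ L ^ 2 * Real.exp (-L))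
    nlinarith

theorem stmt_16 :
    ∃ k₀ : ℕ, 2 ≤ k₀ ∧ ∀ k : ℕ, k₀ ≤ k → ∀ _hk2 : 2 ≤ k,
      Lint k (Fmay k) ⟨k - 2, by omega⟩ ⟨k - 1, by omega⟩
        ≤ (Real.log k / k) ^ 2 * Iint k (Fmay k) := by
  have hev := (Real.tendsto_log_atTop.comp tendsto_natCast_atTop_atTop).eventually
    eventually_conds
  obtain ⟨k₀, hk₀⟩ := Filter.eventually_atTop.1 hev
  refine ⟨max k₀ 2, le_max_right _ _, fun k hk hk2 => ?_⟩
  obtain ⟨c1, c2, c3, c4, c5, c6⟩ := hk₀ k ((le_max_left _ _).trans hk)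
  simp only [Function.comp] at c1 c2 c3 c4 c5 c6
  obtain ⟨lam, c, hlam, hc, hlc, hnum⟩ := numeric k hk2 _ _ rfl rfl c1 c2 c3 c4 c5 c6
  have hA : 0 < Real.log k - 2 * Real.log (Real.log k) := by linarith
  refine (L_le k _ rfl hA hk2 _ _ ?_).trans (hnum.trans
    (mul_le_mul_of_nonneg_left (I_ge k _ rfl hA (by omega) lam c hc hlc hlam) (by positivity)))
  intro h
  have := congrArg Fin.val h
  simp only at this
  omega
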